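/- arXiv:2310.11567 — 5 statements merged into one kernel-verified Lean document; each statement's English description precedes it below -/
import Mathlib

section
/- Let N ≥ 1, s ∈ (0,1), q ∈ ℝ^N, and let T : ℝ^N → ℝ^N be a surjective isometry with T(q) = q and T ∘ T = id. Let A_i, A_e ⊆ ℝ^N be disjoint measurable sets whose union is ℝ^N up to a Lebesgue-null set, and assume T(A_e) ⊆ A_i up to a Lebesgue-null set. Then for every ε > 0, ∫_{ℝ^N∖B_ε(q)} (χ_{A_i}(y) − χ_{A_e}(y)) ‖y−q‖^{−(N+s)} dy = ∫_{(A_i ∖ T(A_e)) ∖ B_ε(q)} ‖y−q‖^{−(N+s)} dy, both sides being finite real numbers. -/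
open MeasureTheory Set

/-- The kernel `‖y - q‖ ^ (-r)` is integrable away from `q` when `r` exceeds the dimension. -/
theorem integrableOn_norm_sub_rpow_neg_compl_ball {E : Type*} [NormedAddCommGroup E]
    [NormedSpace ℝ E] [FiniteDimensional ℝ E] [MeasurableSpace E] [BorelSpace E]
    (μ : Measure E) [μ.IsAddHaarMeasure] {r : ℝ} (hr : (Module.finrank ℝ E : ℝ) < r)
    (q : E) {ε : ℝ} (hε : 0 < ε) :
    IntegrableOn (fun y => ‖y - q‖ ^ (-r)) (Metric.ball q ε)ᶜ μ := by
  have hr0 : 0 < r := (Nat.cast_nonneg _).trans_lt hr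
  have hint : Integrable (fun y => (ε / (1 + ε)) ^ (-r) * (1 + ‖y - q‖) ^ (-r)) μ :=
    ((integrable_one_add_norm (μ := μ) hr).comp_sub_right q).const_mul _
  refine hint.integrableOn.mono' ?_ ?_
  · exact Measurable.aestronglyMeasurable (by fun_prop)
  · refine (ae_restrict_iff' Metric.isOpen_ball.measurableSet.compl).2 (.of_forall fun y hy => ?_)
    have hy' : ε ≤ ‖y - q‖ := by simpa [dist_eq_norm] using hy
    rw [Real.norm_of_nonneg (by positivity), ← Real.mul_rpow (by positivity) (by positivity)]
    refine Real.rpow_le_rpow_of_nonpos (by positivity) ?_ (by linarith)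
    rw [div_mul_eq_mul_div, div_le_iff₀ (by positivity)]
    nlinarith

/-- A surjective isometry of a finite-dimensional inner product space preserves volume. -/
theorem Isometry.measurePreserving_volume_of_surjective {E : Type*} [NormedAddCommGroup E]
    [InnerProductSpace ℝ E] [FiniteDimensional ℝ E] [MeasurableSpace E] [BorelSpace E]
    {T : E → E} (hT : Isometry T) (hTsurj : Function.Surjective T) :
    MeasurePreserving T (volume : Measure E) volume := by
  have h := (IsometryEquiv.mk (Equiv.ofBijective T ⟨hT.injective, hTsurj⟩)
    hT).measurePreserving_euclideanHausdorffMeasure (Module.finrank ℝ E)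
  rwa [InnerProductSpace.euclideanHausdorffMeasure_eq_volume] at h

/-- reflection-trapping identity for the truncated signed kernel integral.
If `T` is a surjective isometric involution fixing `q`, and `T(A_e) ⊆ A_i` up to a null
set, then the truncated signed kernel integral equals the kernel integral over
`(A_i \ T(A_e)) \ B_ε(q)`, both sides being finite. -/
theorem truncated_signed_kernel_integral_reflection
    (N : ℕ) (hN : 1 ≤ N) (s : ℝ) (hs : s ∈ Set.Ioo (0 : ℝ) 1)
    (q : EuclideanSpace ℝ (Fin N))
    (T : EuclideanSpace ℝ (Fin N) → EuclideanSpace ℝ (Fin N))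
    (hT : Isometry T) (hTsurj : Function.Surjective T) (hTq : T q = q)
    (hTT : T ∘ T = id)
    (Ai Ae : Set (EuclideanSpace ℝ (Fin N)))
    (hAi : MeasurableSet Ai) (hAe : MeasurableSet Ae)
    (hdisj : Disjoint Ai Ae) (hcover : volume ((Ai ∪ Ae)ᶜ) = 0)
    (hTAe : volume (T '' Ae \ Ai) = 0)
    (ε : ℝ) (hε : 0 < ε) :
    IntegrableOn
      (fun y => (Ai.indicator (fun _ => (1 : ℝ)) y - Ae.indicator (fun _ => (1 : ℝ)) y) *
        ‖y - q‖ ^ (-((N : ℝ) + s)))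
      ((Metric.ball q ε)ᶜ) volume ∧
    IntegrableOn (fun y => ‖y - q‖ ^ (-((N : ℝ) + s)))
      ((Ai \ T '' Ae) \ Metric.ball q ε) volume ∧
    ∫ y in (Metric.ball q ε)ᶜ,
        (Ai.indicator (fun _ => (1 : ℝ)) y - Ae.indicator (fun _ => (1 : ℝ)) y) *
          ‖y - q‖ ^ (-((N : ℝ) + s)) =
      ∫ y in (Ai \ T '' Ae) \ Metric.ball q ε, ‖y - q‖ ^ (-((N : ℝ) + s)) := by
  set k : EuclideanSpace ℝ (Fin N) → ℝ := fun y => ‖y - q‖ ^ (-((N : ℝ) + s)) with hk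
  set B : Set (EuclideanSpace ℝ (Fin N)) := (Metric.ball q ε)ᶜ with hB
  have hBm : MeasurableSet B := Metric.isOpen_ball.measurableSet.compl
  have hkB : IntegrableOn k B volume :=
    integrableOn_norm_sub_rpow_neg_compl_ball volume (by simpa using hs.1) q hε
  have hemb : MeasurableEmbedding T := hT.isClosedEmbedding.measurableEmbedding
  have hTAem : MeasurableSet (T '' Ae) := hemb.measurableSet_image.2 hAe
  have hdist : ∀ y, ‖T y - q‖ = ‖y - q‖ := fun y => by
    simpa only [hTq, dist_eq_norm] using hT.dist_eq y q
  have hTB : T '' (Ae ∩ B) = T '' Ae ∩ B := by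
    have hpre : T ⁻¹' B = B := by
      ext y
      simp [hB, dist_eq_norm, hdist]
    conv_lhs => rw [← hpre]
    exact image_inter_preimage T Ae B
  have hAe_eq : ∫ y in Ae ∩ B, k y = ∫ y in T '' Ae ∩ B, k y := by
    rw [← hTB, (hT.measurePreserving_volume_of_surjective hTsurj).setIntegral_image_emb hemb]
    simp only [hk, hdist]
  have hsub : (Ai ∩ B ∩ T '' Ae : Set _) =ᵐ[volume] (T '' Ae ∩ B : Set _) := by
    have hle : ∀ᵐ y, y ∉ T '' Ae \ Ai := measure_eq_zero_iff_ae_notMem.1 hTAe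
    filter_upwards [hle] with y hy
    apply propext
    change (y ∈ Ai ∩ B ∩ T '' Ae) ↔ (y ∈ T '' Ae ∩ B)
    simp only [mem_sdiff, mem_inter_iff] at hy ⊢
    tauto
  have hsplit : (fun y => (Ai.indicator (fun _ => (1 : ℝ)) y -
      Ae.indicator (fun _ => (1 : ℝ)) y) * k y) =
      fun y => Ai.indicator k y - Ae.indicator k y := by
    ext y
    by_cases h₁ : y ∈ Ai <;> by_cases h₂ : y ∈ Ae <;> simp [h₁, h₂]
  have hset : (Ai \ T '' Ae) \ Metric.ball q ε = (Ai ∩ B) \ T '' Ae := by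
    ext y
    simp only [hB, mem_sdiff, mem_inter_iff, mem_compl_iff]
    tauto
  have hiAi : IntegrableOn k (Ai ∩ B) volume := hkB.mono_set inter_subset_right
  rw [hset]
  change IntegrableOn (fun y => (Ai.indicator (fun _ => (1 : ℝ)) y -
    Ae.indicator (fun _ => (1 : ℝ)) y) * k y) B volume ∧ IntegrableOn k _ volume ∧
    ∫ y in B, (Ai.indicator (fun _ => (1 : ℝ)) y -
      Ae.indicator (fun _ => (1 : ℝ)) y) * k y = ∫ y in _, k y
  rw [hsplit]
  refine ⟨(hkB.indicator hAi).sub (hkB.indicator hAe), hiAi.mono_set sdiff_subset, ?_⟩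
  rw [integral_sub (hkB.indicator hAi) (hkB.indicator hAe), integral_indicator hAi,
    integral_indicator hAe, Measure.restrict_restrict hAi, Measure.restrict_restrict hAe,
    hAe_eq, ← setIntegral_congr_set hsub, ← integral_inter_add_sdiff hTAem hiAi]
  ring
end

section
/- Let N ≥ 1, s ∈ (0,1), h ∈ ℝ, and let q ∈ ℝ^N have last coordinate q_N = h. Let A_i, A_e ⊆ ℝ^N be disjoint measurable sets whose union is ℝ^N up to a Lebesgue-null set, and assume {x : x_N > h} ⊆ A_e up to a Lebesgue-null set. Then for every ε > 0, ∫_{ℝ^N∖B_ε(q)} (χ_{A_i}(y) − χ_{A_e}(y)) ‖y−q‖^{−(N+s)} dy = −2 ∫_{(A_e ∩ {x : x_N < h}) ∖ B_ε(q)} ‖y−q‖^{−(N+s)} dy ≤ 0; moreover, if the Lebesgue measure of A_e ∩ {x : x_N < h} is positive, then there exists ε₀ > 0 such that the truncated signed kernel integral is strictly negative for all ε ∈ (0, ε₀). -/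
open MeasureTheory Set

/-- The kernel `‖y - q‖ ^ (-r)` is integrable away from `q` when `r` exceeds the dimension. -/
lemma integrableOn_norm_sub_rpow_neg_compl_ball_s6 {N : ℕ} {r : ℝ} (hr : (N : ℝ) < r)
    (q : EuclideanSpace ℝ (Fin N)) {ε : ℝ} (hε : 0 < ε) :
    IntegrableOn (fun y => ‖y - q‖ ^ (-r)) (Metric.ball q ε)ᶜ := by
  have hbound : Integrable (fun y : EuclideanSpace ℝ (Fin N) =>
      (ε / (1 + ε)) ^ (-r) * (1 + ‖y - q‖) ^ (-r)) :=
    ((integrable_one_add_norm (by simpa using hr)).comp_sub_right q).const_mul _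
  have hmeas : Measurable fun y : EuclideanSpace ℝ (Fin N) => ‖y - q‖ ^ (-r) := by fun_prop
  refine hbound.integrableOn.mono' hmeas.aestronglyMeasurable ?_
  refine (ae_restrict_iff' Metric.isOpen_ball.measurableSet.compl).2 (ae_of_all _ fun y hy => ?_)
  have hy' : ε ≤ ‖y - q‖ := by simpa [dist_eq_norm] using hy
  have hr0 : -r ≤ 0 := by linarith [(Nat.cast_nonneg N : (0 : ℝ) ≤ N)]
  rw [Real.norm_of_nonneg (by positivity), ← Real.mul_rpow (by positivity) (by positivity)]
  refine Real.rpow_le_rpow_of_nonpos (by positivity) ?_ hr0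
  rw [div_mul_eq_mul_div, div_le_iff₀ (by positivity)]
  nlinarith

/-- Coordinate hyperplanes are Lebesgue-null. -/
lemma volume_setOf_apply_eq {N : ℕ} (i : Fin N) (h : ℝ) :
    volume {x : EuclideanSpace ℝ (Fin N) | x i = h} = 0 := by
  have hp := PiLp.volume_preserving_ofLp (Fin N)
  have hs : MeasurableSet {x : Fin N → ℝ | x i = h} :=
    measurableSet_eq_fun (measurable_pi_apply i) measurable_const
  exact (hp.measure_preimage hs.nullMeasurableSet).trans
    (Measure.pi_hyperplane (fun _ : Fin N => (volume : Measure ℝ)) i h)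

/-- A function that is odd under the point reflection through `q` has zero integral. -/
lemma integral_eq_zero_of_pointReflection_odd {N : ℕ} (q : EuclideanSpace ℝ (Fin N))
    (g : EuclideanSpace ℝ (Fin N) → ℝ) (hg : ∀ y, g (q + q - y) = -g y) :
    ∫ y, g y = 0 := by
  have h1 := integral_sub_left_eq_self g volume (q + q)
  simp only [hg, integral_neg] at h1
  linarith

/-- The truncated signed kernel integral in terms of the exterior part below the hyperplane. -/
lemma truncated_signed_kernel_integral_eq {N : ℕ} (i : Fin N) {r : ℝ} (hr : (N : ℝ) < r)
    (q : EuclideanSpace ℝ (Fin N)) {Ai Ae : Set (EuclideanSpace ℝ (Fin N))}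
    (hAe : MeasurableSet Ae)
    (hdisj : Disjoint Ai Ae) (hcover : volume ((Ai ∪ Ae)ᶜ) = 0)
    (hupper : volume ({x : EuclideanSpace ℝ (Fin N) | q i < x i} \ Ae) = 0)
    {ε : ℝ} (hε : 0 < ε) :
    ∫ y in (Metric.ball q ε)ᶜ,
        (Ai.indicator (fun _ => (1 : ℝ)) y - Ae.indicator (fun _ => (1 : ℝ)) y) *
          ‖y - q‖ ^ (-r) =
      -2 * ∫ y in (Ae ∩ {x : EuclideanSpace ℝ (Fin N) | x i < q i}) \ Metric.ball q ε,
        ‖y - q‖ ^ (-r) := by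
  set S := (Metric.ball q ε)ᶜ with hS
  set L := {x : EuclideanSpace ℝ (Fin N) | x i < q i} with hL
  set U := {x : EuclideanSpace ℝ (Fin N) | q i < x i} with hU
  set K : EuclideanSpace ℝ (Fin N) → ℝ := fun y => ‖y - q‖ ^ (-r) with hK
  have hci : Continuous fun x : EuclideanSpace ℝ (Fin N) => x i := by fun_prop
  have hmS : MeasurableSet S := Metric.isOpen_ball.measurableSet.compl
  have hmL : MeasurableSet L := (isOpen_lt hci continuous_const).measurableSet
  have hmU : MeasurableSet U := (isOpen_lt continuous_const hci).measurableSet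
  have hint : IntegrableOn K S := integrableOn_norm_sub_rpow_neg_compl_ball_s6 hr q hε
  have hodd : ∫ y in S, (L.indicator K y - U.indicator K y) = 0 := by
    rw [← integral_indicator hmS]
    refine integral_eq_zero_of_pointReflection_odd q _ fun y => ?_
    have hn : ‖q + q - y - q‖ = ‖y - q‖ := by
      rw [← norm_neg]; congr 1; abel
    have hSy : q + q - y ∈ S ↔ y ∈ S := by simp [hS, dist_eq_norm, hn]
    have hLy : q + q - y ∈ L ↔ y ∈ U := by
      simp only [hL, hU, mem_ofPred_eq, PiLp.sub_apply, PiLp.add_apply]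
      constructor <;> intro _ <;> linarith
    have hUy : q + q - y ∈ U ↔ y ∈ L := by
      simp only [hL, hU, mem_ofPred_eq, PiLp.sub_apply, PiLp.add_apply]
      constructor <;> intro _ <;> linarith
    classical
    have hKy : K (q + q - y) = K y := by simp only [hK, hn]
    simp only [indicator_apply, hSy, hLy, hUy, hKy]
    split_ifs <;> ring
  have hae : ∀ᵐ y, (Ai.indicator (fun _ => (1 : ℝ)) y - Ae.indicator (fun _ => (1 : ℝ)) y) * K y =
      (L.indicator K y - U.indicator K y) + -2 * (Ae ∩ L).indicator K y := by
    have h1 : ∀ᵐ y, y ∉ (Ai ∪ Ae)ᶜ := measure_eq_zero_iff_ae_notMem.1 hcover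
    have h2 : ∀ᵐ y, y ∉ U \ Ae := measure_eq_zero_iff_ae_notMem.1 hupper
    have h3 : ∀ᵐ y : EuclideanSpace ℝ (Fin N), y ∉ {x : EuclideanSpace ℝ (Fin N) | x i = q i} :=
      measure_eq_zero_iff_ae_notMem.1 (volume_setOf_apply_eq i (q i))
    filter_upwards [h1, h2, h3] with y hy1 hy2 hy3
    have hnot : y ∈ Ae → y ∉ Ai := fun he hi => Set.disjoint_left.1 hdisj hi he
    rcases lt_or_gt_of_ne (show y i ≠ q i from hy3) with hlt | hgt
    · have hyL : y ∈ L := hlt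
      have hyU : y ∉ U := fun hgt => lt_asymm hlt hgt
      by_cases hye : y ∈ Ae
      · simp [hyL, hyU, hye, hnot hye]; ring
      · have hyi : y ∈ Ai := by
          rcases not_not.1 hy1 with h | h
          exacts [h, absurd h hye]
        simp [hyL, hyU, hye, hyi]
    · have hyU : y ∈ U := hgt
      have hyL : y ∉ L := fun hlt => lt_asymm hlt hgt
      have hye : y ∈ Ae := by_contra fun hne => hy2 ⟨hyU, hne⟩
      simp [hyL, hyU, hye, hnot hye]
  have hsub : IntegrableOn (fun y => L.indicator K y - U.indicator K y) S :=
    (hint.indicator hmL).sub (hint.indicator hmU)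
  rw [integral_congr_ae (ae_restrict_of_ae hae), integral_add hsub
    ((hint.indicator (hAe.inter hmL)).const_mul _), hodd, zero_add, integral_const_mul,
    setIntegral_indicator (hAe.inter hmL), inter_comm, ← sdiff_eq]

/-- If a set of positive measure misses `q`, the kernel has positive integral over the part of the
set outside every sufficiently small ball around `q`. -/
lemma exists_forall_setIntegral_norm_sub_rpow_neg_pos {N : ℕ} {r : ℝ} (hr : (N : ℝ) < r)
    (q : EuclideanSpace ℝ (Fin N)) {B : Set (EuclideanSpace ℝ (Fin N))} (hB : MeasurableSet B)
    (hqB : q ∉ B) (hpos : 0 < volume B) :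
    ∃ ε₀ > (0 : ℝ), ∀ ε ∈ Set.Ioo (0 : ℝ) ε₀,
      0 < ∫ y in B \ Metric.ball q ε, ‖y - q‖ ^ (-r) := by
  have hex : ∃ n : ℕ, 0 < volume (B \ Metric.ball q (1 / ((n : ℝ) + 1))) := by
    by_contra! hall
    refine hpos.ne' (measure_mono_null ?_ (measure_iUnion_null fun n => le_zero_iff.1 (hall n)))
    intro y hy
    have hd : 0 < dist y q := dist_pos.2 fun hyq => hqB (hyq ▸ hy)
    obtain ⟨n, hn⟩ := exists_nat_one_div_lt hd
    exact mem_iUnion.2 ⟨n, hy, fun hmem => lt_asymm hn (Metric.mem_ball.1 hmem)⟩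
  obtain ⟨n, hn⟩ := hex
  refine ⟨1 / ((n : ℝ) + 1), by positivity, fun ε hε => ?_⟩
  have hmeas : MeasurableSet (B \ Metric.ball q ε) := hB.diff Metric.isOpen_ball.measurableSet
  rw [setIntegral_pos_iff_support_of_nonneg_ae (ae_of_all _ fun y => by positivity)
    ((integrableOn_norm_sub_rpow_neg_compl_ball_s6 hr q hε.1).mono_set fun y hy => hy.2)]
  refine hn.trans_le (measure_mono fun y hy => ?_)
  have hyε : y ∉ Metric.ball q ε := fun hmem => hy.2 (Metric.ball_subset_ball hε.2.le hmem)
  have hyq : y - q ≠ 0 := sub_ne_zero.2 fun hyq => hqB (hyq ▸ hy.1)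
  exact ⟨(Real.rpow_pos_of_pos (norm_pos_iff.2 hyq) _).ne', hy.1, hyε⟩

/-- at a point `q` with `q_N = h`, if the exterior set contains the upper
half-space `{x_N > h}` up to a null set, then the truncated signed kernel integral equals
`−2 ∫_{(A_e ∩ {x_N < h}) ∖ B_ε(q)} K_q ≤ 0`, and is strictly negative for small `ε` when
`A_e ∩ {x_N < h}` has positive measure. -/
theorem truncated_signed_kernel_integral_upper_halfspace_exterior
    (N : ℕ) (hN : 1 ≤ N) (s : ℝ) (hs : s ∈ Set.Ioo (0 : ℝ) 1) (h : ℝ)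
    (q : EuclideanSpace ℝ (Fin N)) (hq : q ⟨N - 1, by omega⟩ = h)
    (Ai Ae : Set (EuclideanSpace ℝ (Fin N)))
    (hAi : MeasurableSet Ai) (hAe : MeasurableSet Ae)
    (hdisj : Disjoint Ai Ae) (hcover : volume ((Ai ∪ Ae)ᶜ) = 0)
    (hupper : volume ({x : EuclideanSpace ℝ (Fin N) | h < x ⟨N - 1, by omega⟩} \ Ae) = 0) :
    (∀ ε : ℝ, 0 < ε →
      (∫ y in (Metric.ball q ε)ᶜ,
          (Ai.indicator (fun _ => (1 : ℝ)) y - Ae.indicator (fun _ => (1 : ℝ)) y) *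
            ‖y - q‖ ^ (-((N : ℝ) + s)) =
        -2 * ∫ y in (Ae ∩ {x : EuclideanSpace ℝ (Fin N) | x ⟨N - 1, by omega⟩ < h}) \
            Metric.ball q ε, ‖y - q‖ ^ (-((N : ℝ) + s))) ∧
      (∫ y in (Metric.ball q ε)ᶜ,
          (Ai.indicator (fun _ => (1 : ℝ)) y - Ae.indicator (fun _ => (1 : ℝ)) y) *
            ‖y - q‖ ^ (-((N : ℝ) + s))) ≤ 0) ∧
    (0 < volume (Ae ∩ {x : EuclideanSpace ℝ (Fin N) | x ⟨N - 1, by omega⟩ < h}) →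
      ∃ ε₀ > (0 : ℝ), ∀ ε ∈ Set.Ioo (0 : ℝ) ε₀,
        (∫ y in (Metric.ball q ε)ᶜ,
          (Ai.indicator (fun _ => (1 : ℝ)) y - Ae.indicator (fun _ => (1 : ℝ)) y) *
            ‖y - q‖ ^ (-((N : ℝ) + s))) < 0) := by
  subst hq
  have hr : (N : ℝ) < (N : ℝ) + s := by linarith [hs.1]
  have heq := fun (ε : ℝ) (hε : 0 < ε) =>
    truncated_signed_kernel_integral_eq ⟨N - 1, by omega⟩ hr q hAe hdisj hcover hupper hε
  refine ⟨fun ε hε => ⟨heq ε hε, ?_⟩, fun hpos => ?_⟩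
  · rw [heq ε hε]
    have hnn : 0 ≤ ∫ y in (Ae ∩ {x : EuclideanSpace ℝ (Fin N) |
        x ⟨N - 1, by omega⟩ < q ⟨N - 1, by omega⟩}) \ Metric.ball q ε,
        ‖y - q‖ ^ (-((N : ℝ) + s)) := integral_nonneg fun y => by positivity
    linarith
  · have hci : Continuous fun x : EuclideanSpace ℝ (Fin N) => x ⟨N - 1, by omega⟩ := by fun_prop
    obtain ⟨ε₀, hε₀, hlt⟩ := exists_forall_setIntegral_norm_sub_rpow_neg_pos hr q
      (hAe.inter (isOpen_lt hci continuous_const).measurableSet) (by simp) hpos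
    refine ⟨ε₀, hε₀, fun ε hε => ?_⟩
    rw [heq ε hε.1]
    linarith [hlt ε hε]
end

section
/- Let N ≥ 2, s ∈ (0,1), let w : ℝ^{N−1} → ℝ be of class C², fix q' ∈ ℝ^{N−1} and set q := (q', w(q')) ∈ ℝ^N. Let r > 0 satisfy |w(y') − w(q')| < r for all y' in the open ball B'_r(q') ⊆ ℝ^{N−1}. Let I := {(x', x_N) : x_N < w(x')} be the subgraph and E := {(x', x_N) : x_N > w(x')} the supergraph of w, and let Q := B'_r(q') × (w(q') − r, w(q') + r) ⊆ ℝ^N. Then the limit as ε → 0⁺ of ∫_{Q ∖ B_ε(q)} (χ_I(y) − χ_E(y)) ‖y−q‖^{−(N+s)} dy exists and equals ∫_{B'_r(0)} [ F((w(q'+x') − w(q'))/‖x'‖) + F((w(q'−x') − w(q'))/‖x'‖) ] ‖x'‖^{−(N−1+s)} dx', where F(t) := ∫₀^t (1 + σ²)^{−(N+s)/2} dσ and the last integrand is absolutely integrable on B'_r(0). -/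
open MeasureTheory Set Filter intervalIntegral

/-- The profile function `F(t) = ∫₀^t (1+σ²)^{−(N+s)/2} dσ` of
Barrios–Figalli–Valdinoci. -/
noncomputable def profileF (N : ℕ) (s t : ℝ) : ℝ :=
  ∫ σ in (0 : ℝ)..t, (1 + σ ^ 2) ^ (-(((N : ℝ) + s) / 2))

/-- The kernel `(ρ² + t²)^{-p}` cut off to zero where `ρ² + t² < ε²`. -/
noncomputable def truncKernel (p ε ρ t : ℝ) : ℝ :=
  if ρ ^ 2 + t ^ 2 < ε ^ 2 then 0 else (ρ ^ 2 + t ^ 2) ^ (-p)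

/-- The sign of `a - t`, written as a difference of indicators. -/
noncomputable def sideSign (a t : ℝ) : ℝ :=
  (if t < a then 1 else 0) - (if a < t then 1 else 0)

lemma abs_sideSign_le (a t : ℝ) : |sideSign a t| ≤ 1 := by
  unfold sideSign
  split_ifs <;> norm_num

lemma truncKernel_neg (p ε ρ t : ℝ) : truncKernel p ε ρ (-t) = truncKernel p ε ρ t := by
  simp [truncKernel]

lemma truncKernel_nonneg (p ε ρ t : ℝ) : 0 ≤ truncKernel p ε ρ t := by
  unfold truncKernel
  split_ifs
  · exact le_rfl
  · positivity

lemma truncKernel_le_of_pos {p ε : ℝ} (hp : 0 ≤ p) (hε : 0 < ε) (ρ t : ℝ) :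
    truncKernel p ε ρ t ≤ (ε ^ 2) ^ (-p) := by
  unfold truncKernel
  split_ifs with h
  · positivity
  · exact Real.rpow_le_rpow_of_nonpos (by positivity) (not_lt.1 h) (by linarith)

lemma truncKernel_le {p ρ : ℝ} (hp : 0 ≤ p) (hρ : 0 < ρ) (ε t : ℝ) :
    truncKernel p ε ρ t ≤ (ρ ^ 2) ^ (-p) := by
  unfold truncKernel
  split_ifs with h
  · positivity
  · exact Real.rpow_le_rpow_of_nonpos (by positivity) (by nlinarith [sq_nonneg t]) (by linarith)

lemma measurable_truncKernel (p ε : ℝ) :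
    Measurable (fun z : ℝ × ℝ => truncKernel p ε z.1 z.2) := by
  unfold truncKernel
  refine Measurable.ite (measurableSet_lt (by fun_prop) (by fun_prop)) measurable_const ?_
  fun_prop

lemma intervalIntegrable_truncKernel {p ε : ℝ} (hp : 0 ≤ p) (hε : 0 < ε) (ρ a b : ℝ) :
    IntervalIntegrable (truncKernel p ε ρ) volume a b := by
  refine (intervalIntegrable_const (c := (ε ^ 2) ^ (-p))).mono_fun
    ((measurable_truncKernel p ε).comp measurable_prodMk_left).aestronglyMeasurable ?_
  refine Eventually.of_forall fun t => ?_
  beta_reduce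
  rw [Real.norm_of_nonneg (truncKernel_nonneg _ _ _ _), Real.norm_of_nonneg (by positivity)]
  exact truncKernel_le_of_pos hp hε ρ t

lemma integral_neg_of_even {g : ℝ → ℝ} (hg : ∀ t, g (-t) = g t) (a : ℝ) :
    ∫ t in (0 : ℝ)..(-a), g t = -∫ t in (0 : ℝ)..a, g t := by
  have h := intervalIntegral.integral_comp_neg (a := 0) (b := a) g
  simp only [hg, neg_zero] at h
  rw [h, intervalIntegral.integral_symm]

lemma integral_sideSign_mul_of_even {g : ℝ → ℝ} (hg : ∀ t, g (-t) = g t)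
    (hint : ∀ a b, IntervalIntegrable g volume a b) {a r : ℝ} (ha : |a| < r) :
    ∫ t in Ioo (-r) r, sideSign a t * g t = 2 * ∫ t in (0 : ℝ)..a, g t := by
  obtain ⟨h1, h2⟩ := abs_lt.1 ha
  have e1 : EqOn (fun t => sideSign a t * g t) g (Ioo (-r) a) := fun t ht => by
    simp [sideSign, ht.2, ht.2.not_gt]
  have e2 : EqOn (fun t => sideSign a t * g t) (fun t => -g t) (Ioo a r) := fun t ht => by
    simp [sideSign, ht.1, ht.1.not_gt]
  have i1 : IntervalIntegrable (fun t => sideSign a t * g t) volume (-r) a := by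
    rw [intervalIntegrable_iff_integrableOn_Ioo_of_le h1.le,
      integrableOn_congr_fun e1 measurableSet_Ioo,
      ← intervalIntegrable_iff_integrableOn_Ioo_of_le h1.le]
    exact hint _ _
  have i2 : IntervalIntegrable (fun t => sideSign a t * g t) volume a r := by
    rw [intervalIntegrable_iff_integrableOn_Ioo_of_le h2.le,
      integrableOn_congr_fun e2 measurableSet_Ioo,
      ← intervalIntegrable_iff_integrableOn_Ioo_of_le h2.le]
    exact (hint _ _).neg
  rw [← integral_Ioc_eq_integral_Ioo, ← intervalIntegral.integral_of_le (by linarith),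
    ← intervalIntegral.integral_add_adjacent_intervals i1 i2,
    intervalIntegral.integral_of_le h1.le, intervalIntegral.integral_of_le h2.le,
    integral_Ioc_eq_integral_Ioo, integral_Ioc_eq_integral_Ioo,
    setIntegral_congr_fun measurableSet_Ioo e1, setIntegral_congr_fun measurableSet_Ioo e2,
    ← integral_Ioc_eq_integral_Ioo, ← integral_Ioc_eq_integral_Ioo,
    ← intervalIntegral.integral_of_le h1.le, ← intervalIntegral.integral_of_le h2.le,
    intervalIntegral.integral_neg]
  have k1 := intervalIntegral.integral_interval_sub_left (hint 0 a) (hint 0 (-r))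
  have k2 := intervalIntegral.integral_interval_sub_left (hint 0 r) (hint 0 a)
  have k3 := integral_neg_of_even hg r
  linarith

lemma abs_integral_truncKernel_add_le {p ε ρ : ℝ} (hp : 0 ≤ p) (hε : 0 < ε) (hρ : 0 < ρ)
    (a b : ℝ) :
    |(∫ t in (0 : ℝ)..a, truncKernel p ε ρ t) + ∫ t in (0 : ℝ)..b, truncKernel p ε ρ t| ≤
      (ρ ^ 2) ^ (-p) * |a + b| := by
  have h1 := integral_neg_of_even (truncKernel_neg p ε ρ) b
  have hint := intervalIntegrable_truncKernel hp hε ρ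
  have h2 := intervalIntegral.integral_interval_sub_left (hint 0 a) (hint 0 (-b))
  have h3 := intervalIntegral.norm_integral_le_of_norm_le_const (a := -b) (b := a)
    (f := truncKernel p ε ρ) (C := (ρ ^ 2) ^ (-p)) fun t _ => by
      rw [Real.norm_of_nonneg (truncKernel_nonneg _ _ _ _)]
      exact truncKernel_le hp hρ ε t
  rw [sub_neg_eq_add, Real.norm_eq_abs, ← h2, h1, sub_neg_eq_add] at h3
  exact h3

lemma integral_truncKernel_eq_profileF {N : ℕ} {s ε ρ : ℝ} (hε : 0 < ε) (hρ : ε ≤ ρ) (a : ℝ) :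
    ∫ t in (0 : ℝ)..a, truncKernel (((N : ℝ) + s) / 2) ε ρ t =
      profileF N s (a / ρ) * ρ ^ (-((N : ℝ) - 1 + s)) := by
  have hρ0 : 0 < ρ := hε.trans_le hρ
  have h : ∀ t, truncKernel (((N : ℝ) + s) / 2) ε ρ t =
      ρ ^ (-((N : ℝ) + s)) * (1 + (t / ρ) ^ 2) ^ (-(((N : ℝ) + s) / 2)) := fun t => by
    have h1 : ¬ ρ ^ 2 + t ^ 2 < ε ^ 2 := by nlinarith [sq_nonneg t]
    have h2 : ρ ^ 2 + t ^ 2 = ρ ^ 2 * (1 + (t / ρ) ^ 2) := by field_simp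
    rw [truncKernel, if_neg h1, h2, Real.mul_rpow (by positivity) (by positivity),
      ← Real.rpow_natCast_mul hρ0.le]
    congr 2
    push_cast
    ring
  simp only [h]
  rw [intervalIntegral.integral_const_mul,
    intervalIntegral.integral_comp_div (fun x => (1 + x ^ 2) ^ (-(((N : ℝ) + s) / 2))) hρ0.ne',
    profileF, zero_div, smul_eq_mul, ← mul_assoc, mul_comm (_ * _)]
  congr 1
  rw [← Real.rpow_add_one hρ0.ne']
  congr 1
  ring

section Euclidean

variable {E : Type*} [NormedAddCommGroup E]

/-- The truncated curvature integrand over the cylinder `B_r(0) × (-r, r)`. -/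
noncomputable def cylinderIntegrand (p ε r : ℝ) (u : E → ℝ) (z : E × ℝ) : ℝ :=
  (Metric.ball (0 : E) r ×ˢ Ioo (-r) r).indicator
    (fun z => sideSign (u z.1) z.2 * truncKernel p ε ‖z.1‖ z.2) z

lemma integral_cylinderIntegrand_right {p ε : ℝ} (hp : 0 ≤ p) (hε : 0 < ε) {r : ℝ} {u : E → ℝ}
    (hur : ∀ x ∈ Metric.ball (0 : E) r, |u x| < r) (x : E) :
    ∫ t, cylinderIntegrand p ε r u (x, t) = (Metric.ball (0 : E) r).indicator
      (fun x => 2 * ∫ t in (0 : ℝ)..u x, truncKernel p ε ‖x‖ t) x := by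
  by_cases hx : x ∈ Metric.ball (0 : E) r
  · rw [indicator_of_mem hx, ← integral_sideSign_mul_of_even (truncKernel_neg p ε ‖x‖)
      (intervalIntegrable_truncKernel hp hε ‖x‖) (hur x hx),
      ← MeasureTheory.integral_indicator measurableSet_Ioo]
    congr 1 with t
    by_cases ht : t ∈ Ioo (-r) r
    · rw [indicator_of_mem ht, cylinderIntegrand, indicator_of_mem (mk_mem_prod hx ht)]
    · rw [indicator_of_notMem ht, cylinderIntegrand, indicator_of_notMem fun h => ht h.2]
  · rw [indicator_of_notMem hx]
    simp [cylinderIntegrand, hx]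

variable [NormedSpace ℝ E]

lemma exists_abs_add_sub_two_mul_le_sq [FiniteDimensional ℝ E] {w : E → ℝ} (hw : ContDiff ℝ 2 w)
    (q : E) (r : ℝ) :
    ∃ C : ℝ, 0 ≤ C ∧ ∀ x, ‖x‖ ≤ r →
      |(w (q + x) - w q) + (w (q - x) - w q)| ≤ C * ‖x‖ ^ 2 := by
  have hd : ContDiff ℝ 1 (fderiv ℝ w) := hw.fderiv_right (by norm_num)
  obtain ⟨K, hK⟩ := hd.locallyLipschitz.locallyLipschitzOn.exists_lipschitzOnWith_of_compact
    (s := Metric.closedBall q r) (isCompact_closedBall q r)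
  refine ⟨2 * K, by positivity, fun x hx => ?_⟩
  have hdiff : Differentiable ℝ w := hw.differentiable (by norm_num)
  have hmem : ∀ t ∈ Ico (0 : ℝ) 1, ‖t • x‖ ≤ r := fun t ht => by
    rw [norm_smul, Real.norm_of_nonneg ht.1]
    nlinarith [norm_nonneg x, ht.2]
  have key := norm_image_sub_le_of_norm_deriv_le_segment_01'
    (f := fun t : ℝ => w (q + t • x) + w (q - t • x))
    (f' := fun t => fderiv ℝ w (q + t • x) x + fderiv ℝ w (q - t • x) (-x))
    (C := 2 * K * ‖x‖ ^ 2) ?_ ?_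
  · rw [Real.norm_eq_abs] at key
    simp only [one_smul, zero_smul, add_zero, sub_zero] at key
    convert key using 2
    ring
  · intro t _
    have hx1 : HasDerivAt (fun t : ℝ => t • x) x t := by
      simpa using (hasDerivAt_id t).smul_const x
    have h1 : HasDerivAt (fun t : ℝ => q + t • x) x t := hx1.const_add q
    have h2 : HasDerivAt (fun t : ℝ => q - t • x) (-x) t := hx1.const_sub q
    exact (((hdiff _).hasFDerivAt.comp_hasDerivAt t h1).add
      ((hdiff _).hasFDerivAt.comp_hasDerivAt t h2)).hasDerivWithinAt
  · intro t ht
    have h1 : q + t • x ∈ Metric.closedBall q r := by simpa using hmem t ht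
    have h2 : q - t • x ∈ Metric.closedBall q r := by
      simpa [mem_closedBall_iff_norm] using hmem t ht
    have h3 := hK.norm_sub_le h1 h2
    have h4 : q + t • x - (q - t • x) = (2 * t) • x := by rw [mul_smul, two_smul]; abel
    rw [h4, norm_smul, Real.norm_of_nonneg (by linarith [ht.1])] at h3
    rw [map_neg, ← sub_eq_add_neg, ← sub_apply]
    refine (ContinuousLinearMap.le_opNorm _ _).trans ?_
    have h5 : (K : ℝ) * (2 * t * ‖x‖) ≤ 2 * K * ‖x‖ := by
      nlinarith [mul_nonneg (mul_nonneg K.coe_nonneg (norm_nonneg x))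
        (sub_nonneg.2 ht.2.le)]
    calc _ ≤ (2 * K * ‖x‖) * ‖x‖ := by gcongr; exact h3.trans h5
      _ = _ := by ring

variable [FiniteDimensional ℝ E] [MeasurableSpace E] [BorelSpace E]
  (μ : Measure E) [μ.IsAddHaarMeasure]

lemma integrableOn_norm_rpow_ball [Nontrivial E] {a : ℝ} (ha : -(Module.finrank ℝ E : ℝ) < a)
    (r : ℝ) : IntegrableOn (fun x : E => ‖x‖ ^ a) (Metric.ball 0 r) μ := by
  rw [integrableOn_fun_norm_addHaar μ (f := fun y : ℝ => y ^ a)]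
  have hpos : 0 < Module.finrank ℝ E := Module.finrank_pos
  rcases le_or_gt r 0 with hr | hr
  · simp [Ioo_eq_empty_of_le hr]
  have h := (intervalIntegral.intervalIntegrable_rpow' (a := 0) (b := r)
    (r := (Module.finrank ℝ E : ℝ) - 1 + a) (by linarith))
  rw [intervalIntegrable_iff_integrableOn_Ioo_of_le hr.le] at h
  refine (integrableOn_congr_fun (fun y hy => ?_) measurableSet_Ioo).1 h
  simp only [smul_eq_mul]
  rw [Real.rpow_add hy.1, ← Real.rpow_natCast, Nat.cast_sub hpos, Nat.cast_one]

lemma integrable_cylinderIntegrand {p ε : ℝ} (hp : 0 ≤ p) (hε : 0 < ε) (r : ℝ) {u : E → ℝ}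
    (hu : Measurable u) : Integrable (cylinderIntegrand p ε r u) (μ.prod volume) := by
  have hS : MeasurableSet (Metric.ball (0 : E) r ×ˢ Ioo (-r) r) :=
    measurableSet_ball.prod measurableSet_Ioo
  refine (integrable_indicator_iff hS).2 ?_
  have hk : Measurable fun z : E × ℝ => truncKernel p ε ‖z.1‖ z.2 :=
    (measurable_truncKernel p ε).comp (f := fun z : E × ℝ => (‖z.1‖, z.2)) (by fun_prop)
  have hs : Measurable fun z : E × ℝ => sideSign (u z.1) z.2 := by
    unfold sideSign
    exact (Measurable.ite (measurableSet_lt (by fun_prop) (by fun_prop)) measurable_const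
      measurable_const).sub (Measurable.ite (measurableSet_lt (by fun_prop) (by fun_prop))
      measurable_const measurable_const)
  refine Measure.integrableOn_of_bounded (M := (ε ^ 2) ^ (-p)) ?_
    (hs.mul hk).aestronglyMeasurable (Eventually.of_forall fun z => ?_)
  · rw [Measure.prod_prod]
    exact ENNReal.mul_ne_top measure_ball_lt_top.ne (by simp)
  · rw [norm_mul, Real.norm_eq_abs, Real.norm_of_nonneg (truncKernel_nonneg _ _ _ _)]
    calc _ ≤ 1 * (ε ^ 2) ^ (-p) := mul_le_mul (abs_sideSign_le _ _)
          (truncKernel_le_of_pos hp hε _ _) (truncKernel_nonneg _ _ _ _) zero_le_one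
      _ = _ := one_mul _

/-- The contribution of the antipodal pair `x`, `-x` to the integral over the cylinder. -/
noncomputable def symmetrizedIntegrand (p ε : ℝ) (u : E → ℝ) (x : E) : ℝ :=
  (∫ t in (0 : ℝ)..u x, truncKernel p ε ‖x‖ t) + ∫ t in (0 : ℝ)..u (-x), truncKernel p ε ‖x‖ t

lemma integrableOn_and_integral_symmetrizedIntegrand {p ε : ℝ} (hp : 0 ≤ p) (hε : 0 < ε) {r : ℝ}
    {u : E → ℝ} (hu : Measurable u) (hur : ∀ x ∈ Metric.ball (0 : E) r, |u x| < r) :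
    IntegrableOn (symmetrizedIntegrand p ε u) (Metric.ball 0 r) μ ∧
      ∫ z, cylinderIntegrand p ε r u z ∂(μ.prod volume) =
        ∫ x in Metric.ball 0 r, symmetrizedIntegrand p ε u x ∂μ := by
  have hint := integrable_cylinderIntegrand μ hp hε r hu
  set G : E → ℝ := (Metric.ball (0 : E) r).indicator
    (fun x => 2 * ∫ t in (0 : ℝ)..u x, truncKernel p ε ‖x‖ t) with hG
  have hGi : Integrable G μ := by
    simpa only [integral_cylinderIntegrand_right hp hε hur] using hint.integral_prod_left
  have hsum : ∀ x, (Metric.ball (0 : E) r).indicator (symmetrizedIntegrand p ε u) x =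
      (1 / 2) * (G x + G (-x)) := fun x => by
    by_cases hx : x ∈ Metric.ball (0 : E) r
    · have hx' : -x ∈ Metric.ball (0 : E) r := by simpa using hx
      simp only [hG, indicator_of_mem hx, indicator_of_mem hx', norm_neg, symmetrizedIntegrand]
      ring
    · have hx' : -x ∉ Metric.ball (0 : E) r := by simpa using hx
      simp [hG, indicator_of_notMem hx, indicator_of_notMem hx']
  have hI : Integrable (fun x => (1 / 2) * (G x + G (-x))) μ :=
    (hGi.add hGi.comp_neg).const_mul _
  refine ⟨?_, ?_⟩
  · rw [← integrable_indicator_iff measurableSet_ball]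
    exact hI.congr (Eventually.of_forall fun x => (hsum x).symm)
  · rw [integral_prod _ hint, ← MeasureTheory.integral_indicator measurableSet_ball]
    simp only [integral_cylinderIntegrand_right hp hε hur, hsum]
    rw [MeasureTheory.integral_const_mul, integral_add hGi hGi.comp_neg, integral_neg_eq_self]
    ring

lemma setIntegral_cylinder_diff_ball_eq (w : E → ℝ) (q : E) (p ε r : ℝ) :
    (∫ y in ((Metric.ball q r ×ˢ Ioo (w q - r) (w q + r)) \
        {y : E × ℝ | ‖y.1 - q‖ ^ 2 + (y.2 - w q) ^ 2 < ε ^ 2}),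
      (({p : E × ℝ | p.2 < w p.1}).indicator (fun _ => (1 : ℝ)) y -
        ({p : E × ℝ | w p.1 < p.2}).indicator (fun _ => (1 : ℝ)) y) *
        (‖y.1 - q‖ ^ 2 + (y.2 - w q) ^ 2) ^ (-p) ∂(μ.prod volume)) =
      ∫ z, cylinderIntegrand p ε r (fun x => w (q + x) - w q) z ∂(μ.prod volume) := by
  have hS : MeasurableSet ((Metric.ball q r ×ˢ Ioo (w q - r) (w q + r)) \
      {y : E × ℝ | ‖y.1 - q‖ ^ 2 + (y.2 - w q) ^ 2 < ε ^ 2}) :=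
    (measurableSet_ball.prod measurableSet_Ioo).diff (measurableSet_lt (by fun_prop) (by fun_prop))
  rw [← MeasureTheory.integral_indicator hS,
    ← integral_add_right_eq_self (μ := μ.prod volume) _ ((q, w q) : E × ℝ)]
  congr 1 with ⟨x, t⟩
  have h1 : t + w q < w (q + x) ↔ t < w (q + x) - w q := by rw [lt_sub_iff_add_lt]
  have h2 : w (q + x) < t + w q ↔ w (q + x) - w q < t := by rw [sub_lt_iff_lt_add]
  have h3 : w q - r < t + w q ↔ -r < t := by constructor <;> intro h <;> linarith
  have h4 : t + w q < w q + r ↔ t < r := by constructor <;> intro h <;> linarith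
  classical
  simp only [cylinderIntegrand, Set.indicator_apply, Prod.mk_add_mk, Set.mem_sdiff, mem_prod, mem_Ioo,
    mem_ofPred_eq, mem_ball_iff_norm, add_sub_cancel_right, sub_zero, sideSign, truncKernel,
    add_comm x q, add_sub_cancel_left, h1, h2, h3, h4]
  split_ifs <;> simp_all

end Euclidean

lemma continuous_profileF (N : ℕ) (s : ℝ) : Continuous (profileF N s) := by
  refine intervalIntegral.continuous_primitive (fun a b => Continuous.intervalIntegrable ?_ a b) 0
  exact Continuous.rpow_const (by fun_prop) fun x => Or.inl (by positivity)


/-- graphical representation of the truncated fractional mean curvature of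
the graph of a `C²` function `w` in a cylinder `Q = B'_r(q') × (w(q')−r, w(q')+r)`
centered at the graph point `q = (q', w(q'))`.  We work in
`ℝ^N = ℝ^{N−1} × ℝ` (product Lebesgue measure), writing the Euclidean kernel and the
Euclidean ball `B_ε(q)` explicitly in terms of `‖y' − q'‖² + (y_N − w(q'))²`. -/
theorem graphical_representation_truncated_fractional_mean_curvature
    (N : ℕ) (hN : 2 ≤ N) (s : ℝ) (hs : s ∈ Set.Ioo (0 : ℝ) 1)
    (w : EuclideanSpace ℝ (Fin (N - 1)) → ℝ) (hw : ContDiff ℝ 2 w)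
    (q' : EuclideanSpace ℝ (Fin (N - 1))) (r : ℝ) (hr : 0 < r)
    (hwr : ∀ y' ∈ Metric.ball q' r, |w y' - w q'| < r) :
    IntegrableOn
      (fun x' : EuclideanSpace ℝ (Fin (N - 1)) =>
        (profileF N s ((w (q' + x') - w q') / ‖x'‖) +
            profileF N s ((w (q' - x') - w q') / ‖x'‖)) *
          ‖x'‖ ^ (-((N : ℝ) - 1 + s)))
      (Metric.ball (0 : EuclideanSpace ℝ (Fin (N - 1))) r) volume ∧
    Tendsto
      (fun ε : ℝ =>
        ∫ y in ((Metric.ball q' r ×ˢ Set.Ioo (w q' - r) (w q' + r)) \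
            {y : EuclideanSpace ℝ (Fin (N - 1)) × ℝ |
              ‖y.1 - q'‖ ^ 2 + (y.2 - w q') ^ 2 < ε ^ 2}),
          (({p : EuclideanSpace ℝ (Fin (N - 1)) × ℝ | p.2 < w p.1}).indicator
              (fun _ => (1 : ℝ)) y -
            ({p : EuclideanSpace ℝ (Fin (N - 1)) × ℝ | w p.1 < p.2}).indicator
              (fun _ => (1 : ℝ)) y) *
            (‖y.1 - q'‖ ^ 2 + (y.2 - w q') ^ 2) ^ (-(((N : ℝ) + s) / 2)))
      (nhdsWithin 0 (Set.Ioi 0))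
      (nhds
        (∫ x' in Metric.ball (0 : EuclideanSpace ℝ (Fin (N - 1))) r,
          (profileF N s ((w (q' + x') - w q') / ‖x'‖) +
              profileF N s ((w (q' - x') - w q') / ‖x'‖)) *
            ‖x'‖ ^ (-((N : ℝ) - 1 + s)))) := by
  have : Nonempty (Fin (N - 1)) := ⟨⟨0, by omega⟩⟩
  obtain ⟨hs0, hs1⟩ := hs
  have hp : (0 : ℝ) ≤ ((N : ℝ) + s) / 2 := by positivity
  have hwc : Continuous w := hw.continuous
  set u : EuclideanSpace ℝ (Fin (N - 1)) → ℝ := fun x => w (q' + x) - w q' with hu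
  have hum : Measurable u := by fun_prop
  have hur : ∀ x ∈ Metric.ball (0 : EuclideanSpace ℝ (Fin (N - 1))) r, |u x| < r := fun x hx =>
    hwr _ (by simpa using hx)
  set Φ : EuclideanSpace ℝ (Fin (N - 1)) → ℝ := fun x' =>
    (profileF N s ((w (q' + x') - w q') / ‖x'‖) +
    profileF N s ((w (q' - x') - w q') / ‖x'‖)) * ‖x'‖ ^ (-((N : ℝ) - 1 + s)) with hΦ
  have hΦeq : ∀ ε : ℝ, 0 < ε → ∀ x : EuclideanSpace ℝ (Fin (N - 1)), ε ≤ ‖x‖ →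
      symmetrizedIntegrand (((N : ℝ) + s) / 2) ε u x = Φ x := fun ε hε x hx => by
    simp only [symmetrizedIntegrand, integral_truncKernel_eq_profileF hε hx, hΦ, hu,
      ← sub_eq_add_neg, add_mul]
  obtain ⟨C, hC0, hC⟩ := exists_abs_add_sub_two_mul_le_sq hw q' r
  have hbound : ∀ ε : ℝ, 0 < ε → ∀ x ∈ Metric.ball (0 : EuclideanSpace ℝ (Fin (N - 1))) r, x ≠ 0 →
      ‖symmetrizedIntegrand (((N : ℝ) + s) / 2) ε u x‖ ≤ C * ‖x‖ ^ (2 - ((N : ℝ) + s)) := by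
    intro ε hε x hx hx0
    have hxp : 0 < ‖x‖ := norm_pos_iff.2 hx0
    have h1 := abs_integral_truncKernel_add_le hp hε hxp (u x) (u (-x))
    have h2 := hC x (mem_ball_zero_iff.1 hx).le
    rw [sub_eq_add_neg q' x] at h2
    calc _ ≤ (‖x‖ ^ 2) ^ (-(((N : ℝ) + s) / 2)) * |u x + u (-x)| := h1
      _ ≤ (‖x‖ ^ 2) ^ (-(((N : ℝ) + s) / 2)) * (C * ‖x‖ ^ 2) := by gcongr
      _ = C * ‖x‖ ^ (2 - ((N : ℝ) + s)) := by
        rw [← Real.rpow_natCast_mul hxp.le, mul_left_comm, ← Real.rpow_natCast ‖x‖ 2,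
          ← Real.rpow_add hxp]
        congr 2
        push_cast
        ring
  have hBint : IntegrableOn
      (fun x : EuclideanSpace ℝ (Fin (N - 1)) => C * ‖x‖ ^ (2 - ((N : ℝ) + s)))
      (Metric.ball 0 r) := by
    refine (integrableOn_norm_rpow_ball volume ?_ r).const_mul C
    rw [finrank_euclideanSpace_fin, Nat.cast_sub (by omega)]
    push_cast
    linarith
  have hae : ∀ᵐ x ∂(volume.restrict (Metric.ball (0 : EuclideanSpace ℝ (Fin (N - 1))) r)),
      x ∈ Metric.ball (0 : EuclideanSpace ℝ (Fin (N - 1))) r ∧ x ≠ 0 :=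
    (ae_restrict_mem measurableSet_ball).and
      (ae_restrict_of_ae (compl_mem_ae_iff.2 (measure_singleton 0)))
  have hF := continuous_profileF N s
  have hΦm : Measurable Φ := by
    have h1 := hF.measurable.comp
      (f := fun x' : EuclideanSpace ℝ (Fin (N - 1)) => (w (q' + x') - w q') / ‖x'‖) (by fun_prop)
    have h2 := hF.measurable.comp
      (f := fun x' : EuclideanSpace ℝ (Fin (N - 1)) => (w (q' - x') - w q') / ‖x'‖) (by fun_prop)
    exact (h1.add h2).mul (by fun_prop)
  refine ⟨?_, ?_⟩
  · refine Integrable.mono' hBint hΦm.aestronglyMeasurable ?_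
    filter_upwards [hae] with x hx
    have hxp : 0 < ‖x‖ := norm_pos_iff.2 hx.2
    rw [← hΦeq ‖x‖ hxp x le_rfl]
    exact hbound _ hxp x hx.1 hx.2
  · have key := tendsto_integral_filter_of_dominated_convergence
      (μ := volume.restrict (Metric.ball (0 : EuclideanSpace ℝ (Fin (N - 1))) r))
      (l := nhdsWithin (0 : ℝ) (Ioi 0))
      (F := fun ε => symmetrizedIntegrand (((N : ℝ) + s) / 2) ε u) (f := Φ) _ ?_ ?_ hBint ?_
    · refine key.congr' ?_
      filter_upwards [self_mem_nhdsWithin] with ε hε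
      rw [← (integrableOn_and_integral_symmetrizedIntegrand volume hp hε hum hur).2]
      exact (setIntegral_cylinder_diff_ball_eq volume w q' _ ε r).symm
    · filter_upwards [self_mem_nhdsWithin] with ε hε
      exact (integrableOn_and_integral_symmetrizedIntegrand volume hp hε hum
        hur).1.aestronglyMeasurable
    · filter_upwards [self_mem_nhdsWithin] with ε hε
      filter_upwards [hae] with x hx
      exact hbound ε hε x hx.1 hx.2
    · filter_upwards [hae] with x hx
      refine tendsto_const_nhds.congr' ?_
      filter_upwards [Ioo_mem_nhdsGT (norm_pos_iff.2 hx.2)] with ε hε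
      exact (hΦeq ε hε.1 x hε.2.le).symm
end

section
/- Let N ≥ 2, s ∈ (0,1), let w : ℝ^{N−1} → ℝ be of class C², fix q' ∈ ℝ^{N−1} and r > 0, and let K ≥ 0 be such that the operator norm of the Hessian D²w(y') is at most K for all y' in the closed ball of radius r centered at q'. Then, with F(t) := ∫₀^t (1 + σ²)^{−(N+s)/2} dσ, | ∫_{B'_r(0)} [ F((w(q'+x') − w(q'))/‖x'‖) + F((w(q'−x') − w(q'))/‖x'‖) ] ‖x'‖^{−(N−1+s)} dx' | ≤ (2 (N−1) ω_{N−1} / (1−s)) · K · r^{1−s}, where B'_r(0) ⊆ ℝ^{N−1} and ω_{N−1} denotes the Lebesgue volume of the unit ball of ℝ^{N−1}. -/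
open MeasureTheory Set intervalIntegral

theorem one_add_sq_rpow_neg_le_one {a : ℝ} (ha : 0 ≤ a) (σ : ℝ) : (1 + σ ^ 2) ^ (-a) ≤ 1 :=
  Real.rpow_le_one_of_one_le_of_nonpos (by nlinarith [sq_nonneg σ]) (by linarith)

theorem continuous_one_add_sq_rpow (a : ℝ) : Continuous fun σ : ℝ => (1 + σ ^ 2) ^ a :=
  Continuous.rpow_const (by fun_prop) fun σ => Or.inl (by positivity)

theorem profileF_neg (N : ℕ) (s t : ℝ) : profileF N s (-t) = -profileF N s t := by
  have h := intervalIntegral.integral_comp_neg (a := 0) (b := t)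
    fun σ : ℝ => (1 + σ ^ 2) ^ (-(((N : ℝ) + s) / 2))
  simp only [neg_sq, neg_zero] at h
  rw [profileF, profileF, h, intervalIntegral.integral_symm]

theorem abs_profileF_sub_le (N : ℕ) {s : ℝ} (hs : 0 ≤ s) (a b : ℝ) :
    |profileF N s a - profileF N s b| ≤ |a - b| := by
  have hc := continuous_one_add_sq_rpow (-(((N : ℝ) + s) / 2))
  rw [profileF, profileF, intervalIntegral.integral_interval_sub_left
    (hc.intervalIntegrable _ _) (hc.intervalIntegrable _ _)]
  rw [← one_mul |a - b|, ← Real.norm_eq_abs]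
  refine intervalIntegral.norm_integral_le_of_norm_le_const fun σ _ => ?_
  rw [Real.norm_of_nonneg (by positivity)]
  exact one_add_sq_rpow_neg_le_one (by positivity) σ

theorem abs_profileF_add_le (N : ℕ) {s : ℝ} (hs : 0 ≤ s) (a b : ℝ) :
    |profileF N s a + profileF N s b| ≤ |a + b| := by
  simpa [profileF_neg] using abs_profileF_sub_le N hs a (-b)

/-- Second differences of a `C²` function are controlled by a bound on its Hessian. -/
theorem abs_add_sub_two_mul_le_of_hessian_le {E : Type*} [NormedAddCommGroup E] [NormedSpace ℝ E]
    {w : E → ℝ} (hw : ContDiff ℝ 2 w) {q : E} {r K : ℝ} (hK : 0 ≤ K)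
    (hHess : ∀ y ∈ Metric.closedBall q r, ‖iteratedFDeriv ℝ 2 w y‖ ≤ K) {x : E} (hx : ‖x‖ ≤ r) :
    |w (q + x) + w (q - x) - 2 * w q| ≤ 2 * K * ‖x‖ ^ 2 := by
  have hd : Differentiable ℝ w := hw.differentiable (by norm_num)
  have hd' : Differentiable ℝ (fderiv ℝ w) :=
    (hw.fderiv_right (m := 1) (by norm_num)).differentiable (by norm_num)
  have hlip : ∀ y ∈ Metric.closedBall q r, ∀ z ∈ Metric.closedBall q r,
      ‖fderiv ℝ w y - fderiv ℝ w z‖ ≤ K * ‖y - z‖ := fun y hy z hz =>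
    Convex.norm_image_sub_le_of_norm_fderiv_le (fun p _ => hd' p)
      (fun p hp => by
        rw [← norm_iteratedFDeriv_one, norm_iteratedFDeriv_fderiv]
        exact hHess p hp)
      (convex_closedBall q r) hz hy
  have hderiv : ∀ z, HasFDerivAt (fun z => w (q + z) + w (q - z))
      (fderiv ℝ w (q + z) - fderiv ℝ w (q - z)) z := fun z => by
    have h₁ : HasFDerivAt (fun z => w (q + z)) (fderiv ℝ w (q + z)) z := by
      exact (hd (q + z)).hasFDerivAt.comp z ((hasFDerivAt_id z).const_add q)
    have h₂ : HasFDerivAt (fun z => w (q - z)) (-fderiv ℝ w (q - z)) z := by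
      simpa [Function.comp_def] using
        (hd (q - z)).hasFDerivAt.comp z ((hasFDerivAt_id z).const_sub q)
    rw [sub_eq_add_neg]
    exact h₁.add h₂
  have hbound : ∀ z ∈ Metric.closedBall (0 : E) ‖x‖,
      ‖fderiv ℝ w (q + z) - fderiv ℝ w (q - z)‖ ≤ 2 * K * ‖x‖ := fun z hz => by
    have hz' : ‖z‖ ≤ ‖x‖ := by simpa using hz
    have h := hlip (q + z) (by simpa using hz'.trans hx) (q - z) (by simpa using hz'.trans hx)
    have h2 : ‖q + z - (q - z)‖ ≤ 2 * ‖z‖ := by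
      rw [show q + z - (q - z) = z + z by abel, two_mul]
      exact norm_add_le z z
    nlinarith
  have h := (convex_closedBall (0 : E) ‖x‖).norm_image_sub_le_of_norm_hasFDerivWithin_le
    (fun z _ => (hderiv z).hasFDerivWithinAt) hbound (x := 0) (y := x) (by simp) (by simp)
  simp only [add_zero, sub_zero, Real.norm_eq_abs] at h
  calc _ = |w (q + x) + w (q - x) - (w q + w q)| := by rw [two_mul]
    _ ≤ _ := h.trans_eq (by ring)

theorem pow_sub_one_smul_rpow_neg {n : ℕ} (hn : 0 < n) (a : ℝ) {y : ℝ} (hy : 0 < y) :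
    y ^ (n - 1) • y ^ (-a) = y ^ ((n : ℝ) - 1 - a) := by
  rw [smul_eq_mul, ← Real.rpow_natCast, ← Real.rpow_add hy, Nat.cast_sub hn, Nat.cast_one,
    ← sub_eq_add_neg]

section Radial

variable {E : Type*} [NormedAddCommGroup E] [NormedSpace ℝ E] [FiniteDimensional ℝ E]
  [Nontrivial E] [MeasurableSpace E] [BorelSpace E]

theorem integrableOn_ball_norm_rpow_neg (μ : Measure E) [μ.IsAddHaarMeasure] {a r : ℝ}
    (hr : 0 < r) (ha : a < Module.finrank ℝ E) :
    IntegrableOn (fun x : E => ‖x‖ ^ (-a)) (Metric.ball 0 r) μ := by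
  rw [integrableOn_fun_norm_addHaar μ (f := fun y : ℝ => y ^ (-a)),
    integrableOn_congr_fun (fun y hy => pow_sub_one_smul_rpow_neg Module.finrank_pos a hy.1)
      measurableSet_Ioo, intervalIntegral.integrableOn_Ioo_rpow_iff hr]
  linarith

theorem setIntegral_ball_norm_rpow_neg (μ : Measure E) [μ.IsAddHaarMeasure] {a r : ℝ}
    (hr : 0 < r) (ha : a < Module.finrank ℝ E) :
    ∫ x in Metric.ball (0 : E) r, ‖x‖ ^ (-a) ∂μ =
      Module.finrank ℝ E * μ.real (Metric.ball 0 1) *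
        (r ^ (Module.finrank ℝ E - a) / (Module.finrank ℝ E - a)) := by
  have hind : (Metric.ball (0 : E) r).indicator (fun x => ‖x‖ ^ (-a)) =
      fun x => (Iio r).indicator (fun y : ℝ => y ^ (-a)) ‖x‖ := by
    ext x
    simp [indicator]
  have hcongr : ∀ y ∈ Ioi (0 : ℝ),
      y ^ (Module.finrank ℝ E - 1) • (Iio r).indicator (fun y : ℝ => y ^ (-a)) y =
        (Iio r).indicator (fun y : ℝ => y ^ ((Module.finrank ℝ E : ℝ) - 1 - a)) y := fun y hy => by
    by_cases h : y ∈ Iio r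
    · simpa [h] using pow_sub_one_smul_rpow_neg Module.finrank_pos a hy
    · simp [h]
  rw [← MeasureTheory.integral_indicator measurableSet_ball, hind, integral_fun_norm_addHaar,
    setIntegral_congr_fun measurableSet_Ioi hcongr, setIntegral_indicator measurableSet_Iio,
    Ioi_inter_Iio, ← integral_Ioc_eq_integral_Ioo, ← intervalIntegral.integral_of_le hr.le,
    integral_rpow (Or.inl (by linarith)), Real.zero_rpow (by linarith), nsmul_eq_mul, smul_eq_mul,
    sub_zero, show (Module.finrank ℝ E : ℝ) - 1 - a + 1 = Module.finrank ℝ E - a by ring, mul_assoc]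

end Radial

/-- the cylinder part of the graphical fractional mean curvature of a `C²`
function `w` is bounded by `(2(N−1)ω_{N−1}/(1−s)) · K · r^{1−s}`, where `K` bounds the
operator norm of the Hessian of `w` on the closed ball of radius `r` around `q'` and
`ω_{N−1}` is the volume of the unit ball of `ℝ^{N−1}`. -/
theorem graphical_fractional_mean_curvature_hessian_bound
    (N : ℕ) (hN : 2 ≤ N) (s : ℝ) (hs : s ∈ Set.Ioo (0 : ℝ) 1)
    (w : EuclideanSpace ℝ (Fin (N - 1)) → ℝ) (hw : ContDiff ℝ 2 w)
    (q' : EuclideanSpace ℝ (Fin (N - 1))) (r : ℝ) (hr : 0 < r)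
    (K : ℝ) (hK : 0 ≤ K)
    (hHess : ∀ y' ∈ Metric.closedBall q' r, ‖iteratedFDeriv ℝ 2 w y'‖ ≤ K) :
    |∫ x' in Metric.ball (0 : EuclideanSpace ℝ (Fin (N - 1))) r,
        (profileF N s ((w (q' + x') - w q') / ‖x'‖) +
            profileF N s ((w (q' - x') - w q') / ‖x'‖)) *
          ‖x'‖ ^ (-((N : ℝ) - 1 + s))| ≤
      2 * ((N : ℝ) - 1) *
          (volume (Metric.ball (0 : EuclideanSpace ℝ (Fin (N - 1))) 1)).toReal / (1 - s) *
        K * r ^ (1 - s) := by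
  obtain ⟨hs₀, hs₁⟩ := hs
  have hN' : ((N - 1 : ℕ) : ℝ) = (N : ℝ) - 1 := by
    rw [Nat.cast_sub (by omega), Nat.cast_one]
  have : Nonempty (Fin (N - 1)) := ⟨⟨0, by omega⟩⟩
  have hdim : (Module.finrank ℝ (EuclideanSpace ℝ (Fin (N - 1))) : ℝ) = (N : ℝ) - 1 := by
    rw [finrank_euclideanSpace_fin, hN']
  have ha : (N : ℝ) - 2 + s < Module.finrank ℝ (EuclideanSpace ℝ (Fin (N - 1))) := by
    rw [hdim]
    linarith
  have hpoint : ∀ x ∈ Metric.ball (0 : EuclideanSpace ℝ (Fin (N - 1))) r,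
      ‖(profileF N s ((w (q' + x) - w q') / ‖x‖) + profileF N s ((w (q' - x) - w q') / ‖x‖)) *
        ‖x‖ ^ (-((N : ℝ) - 1 + s))‖ ≤ 2 * K * ‖x‖ ^ (-((N : ℝ) - 2 + s)) := fun x hx => by
    rcases eq_or_ne x 0 with rfl | hx₀
    · simp only [norm_zero, div_zero, profileF, intervalIntegral.integral_same, add_zero, zero_mul]
      positivity
    have hpos : 0 < ‖x‖ := norm_pos_iff.2 hx₀
    have hsum : |profileF N s ((w (q' + x) - w q') / ‖x‖) +
        profileF N s ((w (q' - x) - w q') / ‖x‖)| ≤ 2 * K * ‖x‖ := by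
      refine (abs_profileF_add_le N hs₀.le _ _).trans ?_
      rw [← add_div, abs_div, abs_norm, div_le_iff₀ hpos]
      calc _ = |w (q' + x) + w (q' - x) - 2 * w q'| := by ring_nf
        _ ≤ 2 * K * ‖x‖ ^ 2 :=
          abs_add_sub_two_mul_le_of_hessian_le hw hK hHess (mem_ball_zero_iff.1 hx).le
        _ = _ := by ring
    rw [norm_mul, Real.norm_eq_abs, Real.norm_of_nonneg (by positivity),
      show -((N : ℝ) - 2 + s) = 1 + -((N : ℝ) - 1 + s) by ring, Real.rpow_add hpos,
      Real.rpow_one, ← mul_assoc]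
    gcongr
  calc _ ≤ ∫ x in Metric.ball (0 : EuclideanSpace ℝ (Fin (N - 1))) r,
        2 * K * ‖x‖ ^ (-((N : ℝ) - 2 + s)) :=
        norm_integral_le_of_norm_le ((integrableOn_ball_norm_rpow_neg volume hr ha).const_mul _)
          (ae_restrict_of_forall_mem measurableSet_ball hpoint)
    _ = _ := by
      rw [MeasureTheory.integral_const_mul, setIntegral_ball_norm_rpow_neg volume hr ha, hdim, measureReal_def,
        show (N : ℝ) - 1 - ((N : ℝ) - 2 + s) = 1 - s by ring]
      ring
end

section
/- Let N ≥ 2. For ε ∈ (0, e^{−4}), set δ(ε) := (−log ε)^{−1/2} ∈ (0, 1/2) and define w_ε : ℝ^{N−1} → ℝ by w_ε(x') := −exp(−1/(δ(ε)² − ‖x'‖²)) if ‖x'‖ < δ(ε) and w_ε(x') := 0 otherwise. Then: (i) w_ε is infinitely differentiable on ℝ^{N−1}; (ii) w_ε(0) = −ε; (iii) the function φ(ε) := sup_{x' ∈ ℝ^{N−1}} ‖D²w_ε(x')‖ is finite for each ε and φ(ε) → 0 as ε → 0⁺. -/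
open MeasureTheory Set Filter

/-- The radius `δ(ε) = (−log ε)^{−1/2}` of the support of the bump. -/
noncomputable def bumpRadius (ε : ℝ) : ℝ := (-Real.log ε) ^ (-(1 / 2 : ℝ))

/-- The smooth bump `w_ε` of depth `ε` supported in the ball of radius `δ(ε)` in
`ℝ^n`. -/
noncomputable def bumpFun (n : ℕ) (ε : ℝ) (x' : EuclideanSpace ℝ (Fin n)) : ℝ :=
  if ‖x'‖ < bumpRadius ε then -Real.exp (-1 / (bumpRadius ε ^ 2 - ‖x'‖ ^ 2)) else 0

lemma expNegInvGlue.iteratedFDeriv_zero (n : ℕ) : iteratedFDeriv ℝ n expNegInvGlue 0 = 0 := by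
  have hcont : Continuous (iteratedFDeriv ℝ n expNegInvGlue) :=
    (expNegInvGlue.contDiff (n := n)).continuous_iteratedFDeriv'
  have hneg : Iio (0 : ℝ) ⊆ {t | iteratedFDeriv ℝ n expNegInvGlue t = 0} := by
    intro t ht
    have h : expNegInvGlue =ᶠ[nhds t] fun _ => (0 : ℝ) := by
      filter_upwards [Iio_mem_nhds ht] with s hs
      exact expNegInvGlue.zero_of_nonpos (le_of_lt hs)
    have := (h.iteratedFDeriv ℝ n).eq_of_nhds
    simpa using this
  have hclosed : IsClosed {t | iteratedFDeriv ℝ n expNegInvGlue t = 0} :=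
    isClosed_eq hcont continuous_const
  have h := hclosed.closure_subset_iff.2 hneg
  rw [closure_Iio] at h
  exact h (mem_Iic.2 le_rfl)

lemma expNegInvGlue.eventually_norm_iteratedFDeriv_lt (n : ℕ) {η : ℝ} (hη : 0 < η) :
    ∀ᶠ t in nhds (0 : ℝ), ∀ i ≤ n, ‖iteratedFDeriv ℝ i expNegInvGlue t‖ < η := by
  have h : ∀ i ∈ Iic n, ∀ᶠ t in nhds (0 : ℝ), ‖iteratedFDeriv ℝ i expNegInvGlue t‖ < η := by
    intro i _
    have hcont : Continuous fun t => ‖iteratedFDeriv ℝ i expNegInvGlue t‖ :=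
      (expNegInvGlue.contDiff (n := i)).continuous_iteratedFDeriv'.norm
    refine hcont.continuousAt.eventually_lt continuousAt_const ?_
    simpa [expNegInvGlue.iteratedFDeriv_zero] using hη
  simpa using (eventually_all_finite (finite_Iic n)).2 h

section NormSq

variable {E : Type*} [NormedAddCommGroup E] [InnerProductSpace ℝ E]

lemma norm_iteratedFDeriv_const_sub_norm_sq_le (c : ℝ) {x : E} (hx : ‖x‖ ≤ 1) {i : ℕ}
    (hi1 : 1 ≤ i) (hi2 : i ≤ 2) :
    ‖iteratedFDeriv ℝ i (fun y : E => c - ‖y‖ ^ 2) x‖ ≤ 2 ^ i := by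
  have hd : fderiv ℝ (fun y : E => c - ‖y‖ ^ 2) = fun y => -(2 • innerSL ℝ y) := by
    funext y
    exact ((hasStrictFDerivAt_norm_sq y).hasFDerivAt.const_sub c).fderiv
  obtain rfl | rfl : i = 1 ∨ i = 2 := by omega
  · rw [← norm_iteratedFDeriv_fderiv, hd, norm_iteratedFDeriv_zero, norm_neg, two_nsmul]
    refine (norm_add_le _ _).trans ?_
    rw [innerSL_apply_norm]
    linarith
  · have hd2 : HasFDerivAt (fun y : E => -(2 • innerSL ℝ y)) (-(2 • innerSL ℝ (E := E))) x :=
      (-(2 • innerSL ℝ (E := E))).hasFDerivAt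
    rw [← norm_iteratedFDeriv_fderiv, hd, ← norm_iteratedFDeriv_fderiv, norm_iteratedFDeriv_zero,
      hd2.fderiv, norm_neg, two_nsmul]
    refine (norm_add_le _ _).trans ?_
    have := norm_innerSL_le ℝ (E := E)
    linarith

end NormSq

lemma bumpRadius_pos {ε : ℝ} (h : 0 < -Real.log ε) : 0 < bumpRadius ε :=
  Real.rpow_pos_of_pos h _

lemma bumpRadius_sq {ε : ℝ} (h : 0 < -Real.log ε) : bumpRadius ε ^ 2 = (-Real.log ε)⁻¹ := by
  rw [bumpRadius, ← Real.rpow_natCast, ← Real.rpow_mul h.le, ← Real.rpow_neg_one]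
  norm_num

lemma four_lt_neg_log {ε : ℝ} (h : ε ∈ Ioo (0 : ℝ) (Real.exp (-4))) : 4 < -Real.log ε := by
  have := (Real.log_lt_iff_lt_exp h.1).2 h.2
  linarith

lemma bumpRadius_lt_half {ε : ℝ} (h : 4 < -Real.log ε) : bumpRadius ε < 1 / 2 := by
  have hsq := bumpRadius_sq (by linarith : 0 < -Real.log ε)
  have : (-Real.log ε)⁻¹ < 4⁻¹ := inv_strictAnti₀ (by norm_num) h
  refine lt_of_pow_lt_pow_left₀ 2 (by norm_num) ?_
  rw [hsq]
  norm_num at this ⊢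
  exact this

lemma tendsto_bumpRadius_sq : Tendsto (fun ε => bumpRadius ε ^ 2)
    (nhdsWithin 0 (Ioo (0 : ℝ) (Real.exp (-4)))) (nhds 0) := by
  have h : Tendsto (fun ε => (-Real.log ε)⁻¹) (nhdsWithin 0 (Ioo (0 : ℝ) (Real.exp (-4))))
      (nhds 0) :=
    (tendsto_neg_atBot_atTop.comp Real.tendsto_log_nhdsGT_zero).inv_tendsto_atTop.mono_left
      (nhdsWithin_mono _ Ioo_subset_Ioi_self)
  refine h.congr' ?_
  filter_upwards [self_mem_nhdsWithin] with ε hε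
  exact (bumpRadius_sq (by linarith [four_lt_neg_log hε])).symm

lemma bumpFun_eq_neg_comp (n : ℕ) {ε : ℝ} (h : 0 < bumpRadius ε) :
    bumpFun n ε = -(expNegInvGlue ∘ fun x' => bumpRadius ε ^ 2 - ‖x'‖ ^ 2) := by
  funext x
  have hiff : ‖x‖ < bumpRadius ε ↔ ¬ bumpRadius ε ^ 2 - ‖x‖ ^ 2 ≤ 0 := by
    rw [not_le, sub_pos, sq_lt_sq₀ (norm_nonneg x) h.le]
  by_cases hx : ‖x‖ < bumpRadius ε
  · simp [bumpFun, hx, expNegInvGlue, hiff.1 hx, neg_div]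
  · simp [bumpFun, hx, expNegInvGlue, not_not.1 (mt hiff.2 hx)]

lemma contDiff_bumpFun (n : ℕ) {ε : ℝ} (h : 0 < bumpRadius ε) (m : ℕ∞) :
    ContDiff ℝ m (bumpFun n ε) := by
  rw [bumpFun_eq_neg_comp n h]
  exact (expNegInvGlue.contDiff.comp (contDiff_const.sub (contDiff_norm_sq ℝ))).neg

lemma tsupport_bumpFun_subset (n : ℕ) (ε : ℝ) :
    tsupport (bumpFun n ε) ⊆ Metric.closedBall 0 (bumpRadius ε) := by
  refine closure_minimal (fun x hx => ?_) Metric.isClosed_closedBall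
  by_contra hx'
  rw [mem_closedBall_zero_iff, not_le] at hx'
  exact hx (if_neg hx'.not_gt)

lemma bddAbove_norm_iteratedFDeriv_bumpFun (n : ℕ) {ε : ℝ} (h : 0 < bumpRadius ε) (m : ℕ) :
    BddAbove (range fun x' => ‖iteratedFDeriv ℝ m (bumpFun n ε) x'‖) := by
  have hc : HasCompactSupport (bumpFun n ε) :=
    (isCompact_closedBall _ _).of_isClosed_subset (isClosed_tsupport _)
      (tsupport_bumpFun_subset n ε)
  exact (contDiff_bumpFun n h m).continuous_iteratedFDeriv'.norm.bddAbove_range_of_hasCompactSupport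
    (hc.iteratedFDeriv m).norm

lemma norm_iteratedFDeriv_two_bumpFun_le (n : ℕ) {ε C : ℝ} (h : 0 < bumpRadius ε)
    (h1 : bumpRadius ε ≤ 1)
    (hC : ∀ t ∈ Icc 0 (bumpRadius ε ^ 2), ∀ i ≤ 2, ‖iteratedFDeriv ℝ i expNegInvGlue t‖ ≤ C)
    (x : EuclideanSpace ℝ (Fin n)) :
    ‖iteratedFDeriv ℝ 2 (bumpFun n ε) x‖ ≤ 8 * C := by
  have hC0 : 0 ≤ C := (norm_nonneg _).trans (hC 0 ⟨le_rfl, sq_nonneg _⟩ 0 (by norm_num))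
  by_cases hx : ‖x‖ ≤ bumpRadius ε
  · have hmem : bumpRadius ε ^ 2 - ‖x‖ ^ 2 ∈ Icc 0 (bumpRadius ε ^ 2) :=
      ⟨sub_nonneg.2 (pow_le_pow_left₀ (norm_nonneg x) hx 2), sub_le_self _ (sq_nonneg _)⟩
    have := norm_iteratedFDeriv_comp_le (n := 2) (N := (2 : ℕ∞)) (expNegInvGlue.contDiff)
      (contDiff_const.sub (contDiff_norm_sq ℝ)) le_rfl x (hC _ hmem)
      (fun i => norm_iteratedFDeriv_const_sub_norm_sq_le (bumpRadius ε ^ 2) (hx.trans h1))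
    rw [bumpFun_eq_neg_comp n h, iteratedFDeriv_neg_apply, norm_neg]
    refine this.trans (le_of_eq ?_)
    norm_num [Nat.factorial]
    ring
  · have hz : iteratedFDeriv ℝ 2 (bumpFun n ε) x = 0 := by
      by_contra hne
      exact hx (mem_closedBall_zero_iff.1 (tsupport_bumpFun_subset n ε
        (support_iteratedFDeriv_subset 2 hne)))
    rw [hz, norm_zero]
    positivity

lemma tendsto_iSup_norm_iteratedFDeriv_two_bumpFun (n : ℕ) :
    Tendsto (fun ε => ⨆ x', ‖iteratedFDeriv ℝ 2 (bumpFun n ε) x'‖)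
      (nhdsWithin 0 (Ioo (0 : ℝ) (Real.exp (-4)))) (nhds 0) := by
  rw [Metric.tendsto_nhds]
  intro η hη
  obtain ⟨ρ, hρ, hball⟩ := Metric.eventually_nhds_iff.1
    (expNegInvGlue.eventually_norm_iteratedFDeriv_lt 2 (by positivity : 0 < η / 16))
  filter_upwards [self_mem_nhdsWithin, tendsto_bumpRadius_sq.eventually_lt_const hρ] with ε hε hlt
  have h4 := four_lt_neg_log hε
  have hle : ⨆ x', ‖iteratedFDeriv ℝ 2 (bumpFun n ε) x'‖ ≤ 8 * (η / 16) := by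
    refine ciSup_le (norm_iteratedFDeriv_two_bumpFun_le n (bumpRadius_pos (by linarith))
      (by linarith [bumpRadius_lt_half h4]) fun t ht i hi => (hball ?_ i hi).le)
    rw [Real.dist_eq, sub_zero, abs_of_nonneg ht.1]
    exact ht.2.trans_lt hlt
  rw [Real.dist_eq, sub_zero, abs_of_nonneg (Real.iSup_nonneg fun _ => norm_nonneg _)]
  linarith

lemma bumpFun_zero (n : ℕ) {ε : ℝ} (hε : 0 < ε) (h : 0 < -Real.log ε) :
    bumpFun n ε 0 = -ε := by
  have hpos := bumpRadius_pos h
  simp [bumpFun, hpos, bumpRadius_sq h, Real.exp_log hε]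

/-- for `ε ∈ (0, e^{−4})` one has `δ(ε) ∈ (0, 1/2)`, the bump `w_ε` is
smooth on `ℝ^{N−1}` with `w_ε(0) = −ε`, the supremum `φ(ε)` of the operator norm of its
Hessian is finite, and `φ(ε) → 0` as `ε → 0⁺`. -/
theorem bump_function_properties (N : ℕ) (hN : 2 ≤ N) :
    (∀ ε ∈ Set.Ioo (0 : ℝ) (Real.exp (-4)),
      bumpRadius ε ∈ Set.Ioo (0 : ℝ) (1 / 2) ∧
      ContDiff ℝ (⊤ : ℕ∞) (bumpFun (N - 1) ε) ∧
      bumpFun (N - 1) ε (0 : EuclideanSpace ℝ (Fin (N - 1))) = -ε ∧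
      BddAbove (Set.range fun x' : EuclideanSpace ℝ (Fin (N - 1)) =>
        ‖iteratedFDeriv ℝ 2 (bumpFun (N - 1) ε) x'‖)) ∧
    Tendsto
      (fun ε : ℝ => ⨆ x' : EuclideanSpace ℝ (Fin (N - 1)),
        ‖iteratedFDeriv ℝ 2 (bumpFun (N - 1) ε) x'‖)
      (nhdsWithin 0 (Set.Ioo (0 : ℝ) (Real.exp (-4)))) (nhds 0) := by
  refine ⟨fun ε hε => ?_, tendsto_iSup_norm_iteratedFDeriv_two_bumpFun (N - 1)⟩
  have h4 := four_lt_neg_log hε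
  have hlog : 0 < -Real.log ε := by linarith
  have hpos := bumpRadius_pos hlog
  exact ⟨⟨hpos, bumpRadius_lt_half h4⟩, contDiff_bumpFun _ hpos _, bumpFun_zero _ hε.1 hlog,
    bddAbove_norm_iteratedFDeriv_bumpFun _ hpos 2⟩
end
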